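/- Let φ : (0,∞) → (0,∞) be a C¹ function satisfying (φ₁)–(φ₃), let Ω ⊂ ℝᴺ (N ≥ 1) be a smooth bounded domain, and let a : Ω̄ → [0,∞) be a continuous c_Ω-positive function. Let f : [0,∞) → [0,∞) be continuous with f(0) = 0, f(s) > 0 for s > 0, satisfying limsup_{s→∞} (sup{f(t) : 0 ≤ t ≤ s})/f(s) < ∞, and suppose f does NOT satisfy the φ-Keller–Osserman condition, i.e. ∫₁^∞ dt/Φ⁻¹(F(t)) = ∞ where F(t) = ∫₀^t f. Then there exists no u ∈ C¹(Ω) with u ≥ 0 that is a weak solution of Δ_φ u = a(x)·f(u) in Ω (i.e. ∫_Ω φ(|∇u|)⟨∇u, ∇ψ⟩ dx + ∫_Ω a f(u) ψ dx = 0 for all ψ ∈ C_c^∞(Ω)) and satisfies u(x) → ∞ as dist(x, ∂Ω) → 0. -/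

import Mathlib

open MeasureTheory Real Set Filter RealInnerProductSpace

open Topology

section Mollification

variable {E : Type*} [NormedAddCommGroup E] [InnerProductSpace ℝ E] [FiniteDimensional ℝ E]

theorem gradient_eq_zero_of_notMem_tsupport {ψ : E → ℝ} {x : E} (hx : x ∉ tsupport ψ) :
    gradient ψ x = 0 := by
  rw [gradient, image_eq_zero_of_notMem_tsupport (f := fderiv ℝ ψ)
    (fun h => hx (tsupport_fderiv_subset ℝ h)), map_zero]

theorem ContDiff.continuous_gradient {ψ : E → ℝ} (hψ : ContDiff ℝ 1 ψ) :
    Continuous (gradient ψ) :=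
  (InnerProductSpace.toDual ℝ E).symm.continuous.comp (hψ.continuous_fderiv one_ne_zero)

variable [MeasurableSpace E] [BorelSpace E]

/-- A compactly supported `C¹` function is a `C¹`-uniform limit of smooth functions supported in
an arbitrarily small thickening of its support. -/
theorem exists_contDiff_approx_of_hasCompactSupport {ψ : E → ℝ} (hψ : ContDiff ℝ 1 ψ)
    (hc : HasCompactSupport ψ) {r ε : ℝ} (hr : 0 < r) (hε : 0 < ε) :
    ∃ χ : E → ℝ, ContDiff ℝ (⊤ : ℕ∞) χ ∧ tsupport χ ⊆ Metric.cthickening r (tsupport ψ) ∧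
      (∀ x, |χ x - ψ x| ≤ ε) ∧ ∀ x, ‖gradient χ x - gradient ψ x‖ ≤ ε := by
  have hdc : Continuous (fderiv ℝ ψ) := hψ.continuous_fderiv one_ne_zero
  have hu := hc.uniformContinuous_of_continuous hψ.continuous
  have hdu := (hc.fderiv ℝ).uniformContinuous_of_continuous hdc
  obtain ⟨δ₁, hδ₁, h₁⟩ := Metric.uniformContinuous_iff.1 hu ε hε
  obtain ⟨δ₂, hδ₂, h₂⟩ := Metric.uniformContinuous_iff.1 hdu ε hε
  set δ := min r (min δ₁ δ₂) with hδ
  have hδpos : 0 < δ := by positivity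
  let ρ : ContDiffBump (0 : E) := ⟨δ / 2, δ, by positivity, by linarith⟩
  have hρ : ρ.rOut = δ := rfl
  have hρi : LocallyIntegrable (ρ.normed volume) volume :=
    (ρ.continuous_normed (μ := volume)).locallyIntegrable
  let L := ContinuousLinearMap.lsmul ℝ ℝ (E := ℝ)
  let χ : E → ℝ := MeasureTheory.convolution (ρ.normed volume) ψ L volume
  have hder (x : E) : HasFDerivAt χ (MeasureTheory.convolution (ρ.normed volume) (fderiv ℝ ψ)
      (ContinuousLinearMap.lsmul ℝ ℝ) volume x) x :=
    hc.hasFDerivAt_convolution_right L hρi hψ x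
  refine ⟨χ, ?_, ?_, fun x => ?_, fun x => ?_⟩
  · exact ρ.hasCompactSupport_normed.contDiff_convolution_left L ρ.contDiff_normed
      hψ.continuous.locallyIntegrable
  · refine closure_minimal ?_ Metric.isClosed_cthickening
    refine (support_convolution_subset L).trans ?_
    rw [ρ.support_normed_eq]
    rintro _ ⟨y, hy, z, hz, rfl⟩
    refine Metric.mem_cthickening_of_dist_le _ z _ _ (subset_tsupport _ hz) ?_
    have : ‖y‖ < δ := by simpa using hy
    simpa using this.le.trans (min_le_left _ _)
  · rw [← Real.dist_eq]
    refine ρ.dist_normed_convolution_le hψ.continuous.aestronglyMeasurable fun y hy => ?_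
    exact (h₁ (lt_of_lt_of_le hy ((min_le_right _ _).trans (min_le_left _ _)))).le
  · rw [gradient, gradient, ← map_sub, LinearIsometryEquiv.norm_map, (hder x).fderiv,
      ← dist_eq_norm]
    refine ρ.dist_normed_convolution_le hdc.aestronglyMeasurable fun y hy => ?_
    exact (h₂ (lt_of_lt_of_le hy ((min_le_right _ _).trans (min_le_right _ _)))).le

/-- Weak formulations tested against `C_c^∞` extend to `C_c^1`. -/
theorem weak_eq_of_contDiff_one {Ω : Set E} (hΩ : IsOpen Ω) {V : E → E} {h : E → ℝ}
    (hV : ContinuousOn V Ω) (hh : ContinuousOn h Ω)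
    (hw : ∀ ψ : E → ℝ, ContDiff ℝ (⊤ : ℕ∞) ψ → HasCompactSupport ψ → tsupport ψ ⊆ Ω →
      (∫ x in Ω, ⟪V x, gradient ψ x⟫) + (∫ x in Ω, h x * ψ x) = 0)
    {ψ : E → ℝ} (hψ : ContDiff ℝ 1 ψ) (hc : HasCompactSupport ψ) (hs : tsupport ψ ⊆ Ω) :
    (∫ x in Ω, ⟪V x, gradient ψ x⟫) + (∫ x in Ω, h x * ψ x) = 0 := by
  obtain ⟨r, hr, hrΩ⟩ := hc.isCompact.exists_cthickening_subset_open hΩ hs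
  set K := Metric.cthickening r (tsupport ψ) with hK
  have hKc : IsCompact K := hc.isCompact.cthickening
  have hKm : MeasurableSet K := hKc.isClosed.measurableSet
  have hVK := hV.mono hrΩ
  have hhK := hh.mono hrΩ
  have reduce : ∀ {χ : E → ℝ}, tsupport χ ⊆ K →
      (∫ x in Ω, ⟪V x, gradient χ x⟫) = (∫ x in K, ⟪V x, gradient χ x⟫) ∧
      (∫ x in Ω, h x * χ x) = ∫ x in K, h x * χ x := by
    intro χ hχ
    constructor <;> refine (setIntegral_eq_of_subset_of_forall_sdiff_eq_zero
      hΩ.measurableSet hrΩ fun x hx => ?_)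
    · rw [gradient_eq_zero_of_notMem_tsupport fun h => hx.2 (hχ h), inner_zero_right]
    · rw [image_eq_zero_of_notMem_tsupport fun h => hx.2 (hχ h), mul_zero]
  have hψK : tsupport ψ ⊆ K := Metric.self_subset_cthickening _
  set C := ∫ x in K, (‖V x‖ + |h x|) with hC
  have int1 : ∀ {χ : E → ℝ}, ContDiff ℝ 1 χ → IntegrableOn (fun x => ⟪V x, gradient χ x⟫) K :=
    fun hχ => (hVK.inner hχ.continuous_gradient.continuousOn).integrableOn_compact hKc
  have int2 : ∀ {χ : E → ℝ}, ContDiff ℝ 1 χ → IntegrableOn (fun x => h x * χ x) K :=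
    fun hχ => (hhK.mul hχ.continuous.continuousOn).integrableOn_compact hKc
  have int3 : ∀ {χ : E → ℝ}, ContDiff ℝ 1 χ →
      IntegrableOn (fun x => ⟪V x, gradient χ x⟫ + h x * χ x) K :=
    fun hχ => (int1 hχ).add (int2 hχ)
  have bound : ∀ ε > 0, |(∫ x in Ω, ⟪V x, gradient ψ x⟫) + (∫ x in Ω, h x * ψ x)| ≤ ε * C := by
    intro ε hε
    obtain ⟨χ, hχ, hχs, hχ0, hχ1⟩ := exists_contDiff_approx_of_hasCompactSupport hψ hc hr hε
    have hχ1' : ContDiff ℝ 1 χ := hχ.of_le (by exact_mod_cast le_top)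
    have h0 := hw χ hχ (hKc.of_isClosed_subset (isClosed_tsupport _) hχs) (hχs.trans hrΩ)
    rw [(reduce hχs).1, (reduce hχs).2, ← integral_add (int1 hχ1') (int2 hχ1')] at h0
    rw [(reduce hψK).1, (reduce hψK).2, ← integral_add (int1 hψ) (int2 hψ), ← sub_zero
      (∫ x in K, _), ← h0, ← integral_sub (int3 hψ) (int3 hχ1'),
      hC, ← integral_const_mul, ← Real.norm_eq_abs]
    refine norm_integral_le_of_norm_le
      (((hVK.norm.add hhK.abs).integrableOn_compact hKc).const_mul ε)
      (Eventually.of_forall fun x => ?_)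
    have e : ⟪V x, gradient ψ x⟫ + h x * ψ x - (⟪V x, gradient χ x⟫ + h x * χ x) =
        -(⟪V x, gradient χ x - gradient ψ x⟫ + h x * (χ x - ψ x)) := by
      rw [inner_sub_right]; ring
    rw [e, norm_neg]
    refine (norm_add_le _ _).trans ?_
    have a1 := (norm_inner_le_norm (𝕜 := ℝ) (V x) (gradient χ x - gradient ψ x)).trans
      (mul_le_mul_of_nonneg_left (hχ1 x) (norm_nonneg _))
    have a2 : ‖h x * (χ x - ψ x)‖ ≤ |h x| * ε := by
      rw [norm_mul]; exact mul_le_mul_of_nonneg_left (hχ0 x) (abs_nonneg _)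
    linarith
  have hC0 : 0 ≤ C := integral_nonneg fun x => by positivity
  rw [← abs_nonpos_iff]
  refine le_of_forall_pos_le_add fun ε hε => ?_
  refine (bound (ε / (C + 1)) (by positivity)).trans ?_
  rw [zero_add, div_mul_eq_mul_div, div_le_iff₀ (by positivity)]
  nlinarith

end Mollification

section Comparison

variable {E : Type*} [NormedAddCommGroup E] [InnerProductSpace ℝ E]

theorem inner_flux_sub_nonneg {φ : ℝ → ℝ} (hpos : ∀ t > 0, 0 < φ t)
    (hmono : MonotoneOn (fun t => φ t * t) (Ici 0)) (ξ ζ : E) :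
    0 ≤ ⟪φ ‖ξ‖ • ξ - φ ‖ζ‖ • ζ, ξ - ζ⟫ := by
  have e : ⟪φ ‖ξ‖ • ξ - φ ‖ζ‖ • ζ, ξ - ζ⟫ =
      φ ‖ξ‖ * ‖ξ‖ ^ 2 + φ ‖ζ‖ * ‖ζ‖ ^ 2 - (φ ‖ξ‖ + φ ‖ζ‖) * ⟪ξ, ζ⟫ := by
    simp only [inner_sub_left, inner_sub_right, real_inner_smul_left, real_inner_self_eq_norm_sq,
      real_inner_comm ξ ζ]
    ring
  rw [e]
  rcases eq_or_ne ξ 0 with rfl | hξ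
  · rcases eq_or_ne ζ 0 with rfl | hζ
    · simp
    · have := hpos _ (norm_pos_iff.2 hζ)
      simp only [norm_zero, inner_zero_left]
      have : 0 ≤ φ ‖ζ‖ * ‖ζ‖ ^ 2 := by positivity
      linarith
  rcases eq_or_ne ζ 0 with rfl | hζ
  · have := hpos _ (norm_pos_iff.2 hξ)
    simp only [norm_zero, inner_zero_right]
    have : 0 ≤ φ ‖ξ‖ * ‖ξ‖ ^ 2 := by positivity
    linarith
  have h1 := hpos _ (norm_pos_iff.2 hξ)
  have h2 := hpos _ (norm_pos_iff.2 hζ)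
  have h3 : (φ ‖ξ‖ + φ ‖ζ‖) * ⟪ξ, ζ⟫ ≤ (φ ‖ξ‖ + φ ‖ζ‖) * (‖ξ‖ * ‖ζ‖) :=
    mul_le_mul_of_nonneg_left (real_inner_le_norm _ _) (by positivity)
  have h4 : 0 ≤ (φ ‖ξ‖ * ‖ξ‖ - φ ‖ζ‖ * ‖ζ‖) * (‖ξ‖ - ‖ζ‖) := by
    rcases le_total ‖ξ‖ ‖ζ‖ with h | h
    · have := hmono (norm_nonneg ξ) (norm_nonneg ζ) h
      exact mul_nonneg_of_nonpos_of_nonpos (sub_nonpos.2 this) (sub_nonpos.2 h)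
    · have := hmono (norm_nonneg ζ) (norm_nonneg ξ) h
      exact mul_nonneg (sub_nonneg.2 this) (sub_nonneg.2 h)
  linarith

theorem continuous_flux {φ : ℝ → ℝ} (hφ : ContinuousOn φ (Ioi 0))
    (hcont : ContinuousOn (fun t => φ t * t) (Ici 0)) :
    Continuous fun ξ : E => φ ‖ξ‖ • ξ := by
  refine continuous_iff_continuousAt.2 fun ξ => ?_
  rcases eq_or_ne ξ 0 with rfl | hξ
  · rw [ContinuousAt, smul_zero, tendsto_zero_iff_norm_tendsto_zero]
    have h : Continuous fun ξ : E => φ ‖ξ‖ * ‖ξ‖ :=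
      hcont.comp_continuous continuous_norm fun ξ => norm_nonneg ξ
    have := (h.tendsto 0).norm
    simpa [norm_smul] using this
  · exact ((hφ.continuousAt (Ioi_mem_nhds (norm_pos_iff.2 hξ))).comp
      continuous_norm.continuousAt).smul continuousAt_id

variable [FiniteDimensional ℝ E] [MeasurableSpace E] [BorelSpace E]

theorem ContinuousOn.integrableOn_of_forall_notMem_eq_zero {Ω K : Set E} (hΩ : IsOpen Ω)
    (hK : IsCompact K) (hKΩ : K ⊆ Ω) {g : E → ℝ} (hg : ContinuousOn g Ω)
    (h0 : ∀ x, x ∉ K → g x = 0) : IntegrableOn g Ω :=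
  ((hg.mono hKΩ).integrableOn_compact hK).of_forall_sdiff_eq_zero hΩ.measurableSet
    fun x hx => h0 x hx.2

/-- Comparison between a weak solution `u` of `div (φ(|∇u|)∇u) = h` in `Ω` and a `C¹` solution `w`
of `div (φ(|∇w|)∇w) = D` on the whole space, when `h < D` wherever `u < w`. -/
theorem le_of_weak_solution {Ω K : Set E} (hΩ : IsOpen Ω) (hK : IsCompact K) (hKΩ : K ⊆ Ω)
    {φ : ℝ → ℝ} (hpos : ∀ t > 0, 0 < φ t) (hφ : ContinuousOn φ (Ioi 0))
    (hcont : ContinuousOn (fun t => φ t * t) (Ici 0))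
    (hmono : MonotoneOn (fun t => φ t * t) (Ici 0))
    {u w h D : E → ℝ} (hu : ContDiffOn ℝ 1 u Ω) (hw : ContDiff ℝ 1 w)
    (hh : ContinuousOn h Ω) (hD : Continuous D)
    (hweak : ∀ ψ : E → ℝ, ContDiff ℝ (⊤ : ℕ∞) ψ → HasCompactSupport ψ → tsupport ψ ⊆ Ω →
      (∫ x in Ω, φ ‖gradient u x‖ * ⟪gradient u x, gradient ψ x⟫) + (∫ x in Ω, h x * ψ x) = 0)
    (hweak' : ∀ ψ : E → ℝ, ContDiff ℝ 1 ψ → HasCompactSupport ψ →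
      (∫ x, ⟪φ ‖gradient w x‖ • gradient w x, gradient ψ x⟫) + (∫ x, D x * ψ x) = 0)
    (hlt : ∀ x ∈ Ω, u x < w x → h x < D x) (hle : ∀ x ∈ Ω, x ∉ K → w x ≤ u x) :
    ∀ x ∈ Ω, w x ≤ u x := by
  intro x₀ hx₀
  by_contra! hx₀'
  have hη : ContDiff ℝ 1 expNegInvGlue := expNegInvGlue.contDiff (n := 1)
  let ψ : E → ℝ := Ω.indicator fun x => expNegInvGlue (w x - u x)
  have hψΩ {x : E} (hx : x ∈ Ω) : ψ x = expNegInvGlue (w x - u x) := indicator_of_mem hx _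
  have hψ0 : ∀ x, x ∉ K → ψ x = 0 := fun x hx => by
    by_cases hxΩ : x ∈ Ω
    · rw [hψΩ hxΩ, expNegInvGlue.zero_of_nonpos (sub_nonpos.2 (hle x hxΩ hx))]
    · exact indicator_of_notMem hxΩ _
  have hψs : tsupport ψ ⊆ K :=
    closure_minimal (fun x hx => by_contra fun h => hx (hψ0 x h)) hK.isClosed
  have hψc : HasCompactSupport ψ := hK.of_isClosed_subset (isClosed_tsupport _) hψs
  have hev {x : E} (hx : x ∈ Ω) : ψ =ᶠ[𝓝 x] fun x => expNegInvGlue (w x - u x) :=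
    (hΩ.eventually_mem hx).mono fun y hy => hψΩ hy
  have hψ : ContDiff ℝ 1 ψ := by
    refine contDiff_iff_contDiffAt.2 fun x => ?_
    by_cases hx : x ∈ Ω
    · exact (hη.contDiffAt.comp x (hw.contDiffAt.sub
        (hu.contDiffAt (hΩ.mem_nhds hx)))).congr_of_eventuallyEq (hev hx)
    · refine contDiffAt_const (c := (0 : ℝ)) |>.congr_of_eventuallyEq ?_
      exact (hK.isClosed.isOpen_compl.eventually_mem fun h => hx (hKΩ h)).mono hψ0
  have hgrad {x : E} (hx : x ∈ Ω) :
      gradient ψ x = deriv expNegInvGlue (w x - u x) • (gradient w x - gradient u x) := by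
    have h1 := (hw.differentiable one_ne_zero x).hasFDerivAt
    have h2 := ((hu.contDiffAt (hΩ.mem_nhds hx)).differentiableAt one_ne_zero).hasFDerivAt
    have h3 := (hη.differentiable one_ne_zero (w x - u x)).hasDerivAt.comp_hasFDerivAt x
      (h1.sub h2)
    have h4 := (h3.congr_of_eventuallyEq (hev hx)).fderiv
    rw [gradient, h4, map_smul, map_sub]
    rfl
  have hgu : ContinuousOn (gradient u) Ω :=
    (InnerProductSpace.toDual ℝ E).symm.continuous.comp_continuousOn
      (hu.continuousOn_fderiv_of_isOpen hΩ le_rfl)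
  have hq := continuous_flux (E := E) hφ hcont
  have hVu : ContinuousOn (fun x => φ ‖gradient u x‖ • gradient u x) Ω := hq.comp_continuousOn hgu
  have hVw : Continuous (fun x => φ ‖gradient w x‖ • gradient w x) :=
    hq.comp hw.continuous_gradient
  have hgψ := hψ.continuous_gradient
  have hgψ0 : ∀ x, x ∉ K → gradient ψ x = 0 := fun x hx =>
    gradient_eq_zero_of_notMem_tsupport fun h => hx (hψs h)
  have id1 := weak_eq_of_contDiff_one hΩ hVu hh
    (by simpa only [real_inner_smul_left] using hweak) hψ hψc (hψs.trans hKΩ)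
  have id2 := hweak' ψ hψ hψc
  have e1 : ∫ x in Ω, ⟪φ ‖gradient w x‖ • gradient w x, gradient ψ x⟫ =
      ∫ x, ⟪φ ‖gradient w x‖ • gradient w x, gradient ψ x⟫ :=
    setIntegral_eq_integral_of_forall_compl_eq_zero fun x hx => by
      rw [hgψ0 x fun h => hx (hKΩ h), inner_zero_right]
  have e2 : ∫ x in Ω, D x * ψ x = ∫ x, D x * ψ x :=
    setIntegral_eq_integral_of_forall_compl_eq_zero fun x hx => by
      rw [hψ0 x fun h => hx (hKΩ h), mul_zero]
  rw [← e1, ← e2] at id2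
  have cu := hVu.inner (𝕜 := ℝ) hgψ.continuousOn
  have cw := hVw.continuousOn (s := Ω) |>.inner (𝕜 := ℝ) hgψ.continuousOn
  have ch : ContinuousOn (fun x => h x * ψ x) Ω := hh.mul hψ.continuous.continuousOn
  have cD : ContinuousOn (fun x => D x * ψ x) Ω := (hD.mul hψ.continuous).continuousOn (s := Ω)
  have iu := cu.integrableOn_of_forall_notMem_eq_zero hΩ hK hKΩ fun x hx => by
    simp [hgψ0 x hx]
  have iw := cw.integrableOn_of_forall_notMem_eq_zero hΩ hK hKΩ fun x hx => by
    simp [hgψ0 x hx]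
  have ih := ch.integrableOn_of_forall_notMem_eq_zero hΩ hK hKΩ fun x hx => by
    simp [hψ0 x hx]
  have iD := cD.integrableOn_of_forall_notMem_eq_zero hΩ hK hKΩ fun x hx => by
    simp [hψ0 x hx]
  let P : E → ℝ := fun x => ⟪φ ‖gradient w x‖ • gradient w x, gradient ψ x⟫ -
    ⟪φ ‖gradient u x‖ • gradient u x, gradient ψ x⟫
  let Q : E → ℝ := fun x => D x * ψ x - h x * ψ x
  have hP : ∀ x ∈ Ω, 0 ≤ P x := fun x hx => by
    simp only [P]
    rw [← inner_sub_left, hgrad hx, real_inner_smul_right]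
    exact mul_nonneg expNegInvGlue.monotone.deriv_nonneg (inner_flux_sub_nonneg hpos hmono _ _)
  have hQ : ∀ x ∈ Ω, 0 ≤ Q x := fun x hx => by
    simp only [Q]
    rw [← sub_mul, hψΩ hx]
    rcases le_or_gt (w x) (u x) with h | h
    · rw [expNegInvGlue.zero_of_nonpos (sub_nonpos.2 h), mul_zero]
    · exact mul_nonneg (sub_nonneg.2 (hlt x hx h).le) (expNegInvGlue.nonneg _)
  have hQ₀ : 0 < Q x₀ := by
    simp only [Q]
    rw [← sub_mul, hψΩ hx₀]
    exact mul_pos (sub_pos.2 (hlt x₀ hx₀ hx₀')) (expNegInvGlue.pos_of_pos (sub_pos.2 hx₀'))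
  have hsum : (∫ x in Ω, P x) + ∫ x in Ω, Q x = 0 := by
    rw [integral_sub iw iu, integral_sub iD ih]
    linarith
  have hPint : 0 ≤ ∫ x in Ω, P x := setIntegral_nonneg hΩ.measurableSet hP
  have hQint : 0 ≤ ∫ x in Ω, Q x := setIntegral_nonneg hΩ.measurableSet hQ
  have hQzero : ∫ x in Ω, Q x = 0 := by linarith
  rw [setIntegral_eq_zero_iff_of_nonneg_ae
    ((ae_restrict_iff' hΩ.measurableSet).2 (Eventually.of_forall hQ)) (iD.sub ih)] at hQzero
  have := Measure.eqOn_open_of_ae_eq hQzero hΩ (cD.sub ch) continuousOn_const hx₀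
  exact hQ₀.ne' this

end Comparison

section Young

/-- The lower bound on the logarithmic derivative of `t ↦ φ t * t` forces it to vanish
continuously at the origin. -/
theorem continuousOn_mul_self {φ : ℝ → ℝ} (hφC1 : ContDiffOn ℝ 1 φ (Ioi 0))
    (hφpos : ∀ t > 0, 0 < φ t) {l₁ : ℝ} (hl₁ : 0 < l₁)
    (hφ3 : ∀ t > 0, l₁ ≤ deriv (fun s => φ s * s) t * t / (φ t * t)) :
    ContinuousOn (fun t => φ t * t) (Ici 0) := by
  have hd : ∀ t > 0, DifferentiableAt ℝ (fun s => φ s * s) t := fun t ht =>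
    ((hφC1.contDiffAt (Ioi_mem_nhds ht)).differentiableAt one_ne_zero).mul differentiableAt_id
  have hq : ∀ t > 0, HasDerivAt (fun s => φ s * s * s ^ (-l₁))
      (deriv (fun s => φ s * s) t * t ^ (-l₁) + φ t * t * (-l₁ * t ^ (-l₁ - 1))) t := fun t ht =>
    (hd t ht).hasDerivAt.mul (Real.hasDerivAt_rpow_const (Or.inl ht.ne'))
  have hmono : MonotoneOn (fun s => φ s * s * s ^ (-l₁)) (Ioi 0) := by
    refine monotoneOn_of_deriv_nonneg (convex_Ioi 0)
      (fun t ht => (hq t ht).continuousAt.continuousWithinAt) ?_ ?_ <;> rw [interior_Ioi]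
    · exact fun t ht => (hq t ht).differentiableAt.differentiableWithinAt
    · intro t ht
      have ht' : 0 < t := ht
      have h := hφ3 t ht
      rw [le_div_iff₀ (mul_pos (hφpos t ht) ht)] at h
      have hpow : t ^ (-l₁) = t ^ (-l₁ - 1) * t := by
        rw [← Real.rpow_add_one ht'.ne']; ring_nf
      rw [(hq t ht).deriv, hpow]
      have : 0 < t ^ (-l₁ - 1) := Real.rpow_pos_of_pos ht _
      nlinarith
  intro t ht
  rcases (mem_Ici.1 ht).eq_or_lt with rfl | ht
  · rw [ContinuousWithinAt, mul_zero]
    have hlim : Tendsto (fun t : ℝ => φ 1 * t ^ l₁) (𝓝[Ici 0] 0) (𝓝 0) := by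
      have : Tendsto (fun t : ℝ => φ 1 * t ^ l₁) (𝓝 0) (𝓝 (φ 1 * 0 ^ l₁)) :=
        ((Real.continuous_rpow_const hl₁.le).const_mul _).tendsto _
      rw [Real.zero_rpow hl₁.ne', mul_zero] at this
      exact this.mono_left nhdsWithin_le_nhds
    have hmem : ∀ᶠ t : ℝ in 𝓝[Ici 0] 0, t ∈ Icc (0 : ℝ) 1 := by
      filter_upwards [self_mem_nhdsWithin, nhdsWithin_le_nhds (Iio_mem_nhds one_pos)] with t h h'
      exact ⟨h, le_of_lt h'⟩
    refine squeeze_zero' (hmem.mono fun t ht => ?_) (hmem.mono fun t ht => ?_) hlim <;>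
      rcases ht.1.eq_or_lt with rfl | h0
    · simp
    · exact (mul_pos (hφpos t h0) h0).le
    · simp [Real.zero_rpow hl₁.ne']
    · have := hmono h0 (mem_Ioi.2 one_pos) ht.2
      simp only [Real.one_rpow, mul_one, Real.rpow_neg h0.le] at this
      rwa [← div_eq_mul_inv, div_le_iff₀ (Real.rpow_pos_of_pos h0 _)] at this
  · exact (hd t ht).continuousAt.continuousWithinAt

variable {p Φ Φinv : ℝ → ℝ}

theorem intervalIntegrable_of_continuousOn_Ici {g : ℝ → ℝ} (hg : ContinuousOn g (Ici 0)) {a b : ℝ}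
    (ha : 0 ≤ a) (hb : 0 ≤ b) : IntervalIntegrable g volume a b :=
  (hg.mono fun _ hx => (le_min ha hb).trans hx.1).intervalIntegrable

theorem hasDerivAt_youngFunction (hp : ContinuousOn p (Ici 0))
    (hΦ : ∀ t, Φ t = ∫ s in (0 : ℝ)..|t|, p s) {t : ℝ} (ht : 0 < t) : HasDerivAt Φ (p t) t := by
  have hpc : ContinuousAt p t := hp.continuousAt (Ici_mem_nhds ht)
  have h := intervalIntegral.integral_hasDerivAt_right
    (intervalIntegrable_of_continuousOn_Ici hp le_rfl ht.le)
    ((hp.mono Ioi_subset_Ici_self).stronglyMeasurableAtFilter isOpen_Ioi t ht) hpc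
  refine h.congr_of_eventuallyEq ?_
  filter_upwards [Ioi_mem_nhds ht] with s hs
  rw [hΦ, abs_of_pos hs]

theorem strictMonoOn_youngFunction (hp : ContinuousOn p (Ici 0)) (hpos : ∀ t > 0, 0 < p t)
    (hΦ : ∀ t, Φ t = ∫ s in (0 : ℝ)..|t|, p s) : StrictMonoOn Φ (Ici 0) := by
  intro a ha b hb hab
  have ha' : 0 ≤ a := ha
  rw [hΦ, hΦ, abs_of_nonneg ha', abs_of_nonneg hb, ← sub_pos,
    intervalIntegral.integral_interval_sub_left (intervalIntegrable_of_continuousOn_Ici hp le_rfl hb)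
      (intervalIntegrable_of_continuousOn_Ici hp le_rfl ha)]
  exact intervalIntegral.intervalIntegral_pos_of_pos_on
    (intervalIntegrable_of_continuousOn_Ici hp ha hb) (fun x hx => hpos x (ha'.trans_lt hx.1)) hab

theorem mul_youngFunction_le (hp : ContinuousOn p (Ici 0)) (hmono : MonotoneOn p (Ici 0))
    (hΦ : ∀ t, Φ t = ∫ s in (0 : ℝ)..|t|, p s) {C t : ℝ} (hC : 1 ≤ C) (ht : 0 ≤ t) :
    C * Φ t ≤ Φ (C * t) := by
  have hC0 : 0 ≤ C := zero_le_one.trans hC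
  rw [hΦ, hΦ, abs_of_nonneg ht, abs_of_nonneg (mul_nonneg hC0 ht)]
  have e := intervalIntegral.mul_integral_comp_mul_left (f := p) (a := 0) (b := t) C
  rw [mul_zero] at e
  rw [← e]
  refine mul_le_mul_of_nonneg_left (intervalIntegral.integral_mono_on ht
    (intervalIntegrable_of_continuousOn_Ici hp le_rfl ht) ?_ fun x hx => ?_) hC0
  · exact intervalIntegrable_of_continuousOn_Ici (hp.comp (by fun_prop)
      fun x hx => mul_nonneg hC0 hx) le_rfl ht
  · exact hmono hx.1 (mul_nonneg hC0 hx.1) (le_mul_of_one_le_left hx.1 hC)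

theorem strictMonoOn_youngInverse (hS : StrictMonoOn Φ (Ici 0))
    (hnonneg : ∀ t ≥ 0, 0 ≤ Φinv t) (hright : ∀ t ≥ 0, Φ (Φinv t) = t) :
    StrictMonoOn Φinv (Ici 0) := by
  intro a ha b hb hab
  rw [← hright a ha, ← hright b hb] at hab
  exact (hS.lt_iff_lt (hnonneg a ha) (hnonneg b hb)).1 hab

theorem youngInverse_pos (hΦ0 : Φ 0 = 0) (hnonneg : ∀ t ≥ 0, 0 ≤ Φinv t)
    (hright : ∀ t ≥ 0, Φ (Φinv t) = t) {s : ℝ} (hs : 0 < s) : 0 < Φinv s := by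
  refine (hnonneg s hs.le).lt_of_ne fun h => ?_
  have := hright s hs.le
  rw [← h, hΦ0] at this
  exact hs.ne this

theorem hasDerivAt_youngInverse (hp : ContinuousOn p (Ici 0)) (hpos : ∀ t > 0, 0 < p t)
    (hΦ : ∀ t, Φ t = ∫ s in (0 : ℝ)..|t|, p s) (hnonneg : ∀ t ≥ 0, 0 ≤ Φinv t)
    (hleft : ∀ t ≥ 0, Φinv (Φ t) = t) (hright : ∀ t ≥ 0, Φ (Φinv t) = t) {s : ℝ} (hs : 0 < s) :
    HasDerivAt Φinv (p (Φinv s))⁻¹ s := by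
  have hΦ0 : Φ 0 = 0 := by simp [hΦ]
  have hS := strictMonoOn_youngFunction hp hpos hΦ
  have hIpos := youngInverse_pos hΦ0 hnonneg hright hs
  refine HasDerivAt.of_local_left_inverse ?_ (hasDerivAt_youngFunction hp hΦ hIpos)
    (hpos _ hIpos).ne' ((Ioi_mem_nhds hs : Ioi (0 : ℝ) ∈ 𝓝 s) |> fun h => by
      filter_upwards [h] with y hy using hright y (le_of_lt hy))
  refine StrictMonoOn.continuousAt_of_image_mem_nhds
    ((strictMonoOn_youngInverse hS hnonneg hright).mono Ioi_subset_Ici_self) (Ioi_mem_nhds hs)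
    (mem_of_superset (Ioi_mem_nhds hIpos) fun t ht => ⟨Φ t, ?_, hleft t (le_of_lt ht)⟩)
  have := hS self_mem_Ici (mem_Ici.2 (le_of_lt ht)) ht
  rwa [hΦ0] at this

theorem youngInverse_mul_le (hp : ContinuousOn p (Ici 0)) (hpos : ∀ t > 0, 0 < p t)
    (hmono : MonotoneOn p (Ici 0)) (hΦ : ∀ t, Φ t = ∫ s in (0 : ℝ)..|t|, p s)
    (hnonneg : ∀ t ≥ 0, 0 ≤ Φinv t) (hright : ∀ t ≥ 0, Φ (Φinv t) = t) {C s : ℝ}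
    (hC : 1 ≤ C) (hs : 0 ≤ s) : Φinv (C * s) ≤ C * Φinv s := by
  have hC0 : 0 ≤ C := zero_le_one.trans hC
  have h := mul_youngFunction_le hp hmono hΦ hC (hnonneg s hs)
  rw [hright s hs, ← hright (C * s) (mul_nonneg hC0 hs)] at h
  exact ((strictMonoOn_youngFunction hp hpos hΦ).le_iff_le (hnonneg _ (mul_nonneg hC0 hs))
    (mul_nonneg hC0 (hnonneg s hs))).1 h

end Young

section AutonomousODE

/-- Global solution of `W' = g(W)` when `∫ 1/g` diverges in both directions. -/
theorem exists_global_solution {g : ℝ → ℝ} (hg : Continuous g) (hpos : ∀ s, 0 < g s)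
    (htop : Tendsto (fun s => ∫ t in (0 : ℝ)..s, (g t)⁻¹) atTop atTop)
    (hbot : Tendsto (fun s => ∫ t in (0 : ℝ)..s, (g t)⁻¹) atBot atBot) :
    ∃ W : ℝ → ℝ, (∀ y, HasDerivAt W (g (W y)) y) ∧ Tendsto W atTop atTop := by
  have hgi : Continuous fun t => (g t)⁻¹ := hg.inv₀ fun t => (hpos t).ne'
  set T : ℝ → ℝ := fun s => ∫ t in (0 : ℝ)..s, (g t)⁻¹ with hT
  have hder (s : ℝ) : HasDerivAt T (g s)⁻¹ s := hgi.integral_hasStrictDerivAt 0 s |>.hasDerivAt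
  have hcont : Continuous T := continuous_iff_continuousAt.2 fun s => (hder s).continuousAt
  have hS : StrictMono T := strictMono_of_deriv_pos fun s => by
    rw [(hder s).deriv]; exact inv_pos.2 (hpos s)
  let e := hS.orderIsoOfSurjective T (hcont.surjective htop hbot)
  refine ⟨e.symm, fun y => ?_, e.symm.tendsto_atTop⟩
  have := HasDerivAt.of_local_left_inverse e.symm.continuous.continuousAt (hder (e.symm y))
    (inv_pos.2 (hpos _)).ne' (Eventually.of_forall fun y => e.apply_symm_apply y)
  rwa [inv_inv] at this

end AutonomousODE

section RunningSup

variable {f : ℝ → ℝ}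

/-- The running supremum of `f` over `[0, s]`, extended to negative `s` by its value at `0`. -/
noncomputable def runningSup (f : ℝ → ℝ) (s : ℝ) : ℝ := sSup (f '' Icc 0 (max s 0))

theorem bddAbove_image_Icc (hf : ContinuousOn f (Ici 0)) (s : ℝ) :
    BddAbove (f '' Icc 0 s) :=
  (isCompact_Icc.image_of_continuousOn (hf.mono Icc_subset_Ici_self)).bddAbove

theorem le_runningSup (hf : ContinuousOn f (Ici 0)) {s : ℝ} (hs : 0 ≤ s) :
    f s ≤ runningSup f s :=
  le_csSup (bddAbove_image_Icc hf _) ⟨s, ⟨hs, le_max_left _ _⟩, rfl⟩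

theorem monotone_runningSup (hf : ContinuousOn f (Ici 0)) : Monotone (runningSup f) :=
  fun _ _ hst => csSup_le_csSup (bddAbove_image_Icc hf _)
    ⟨_, 0, ⟨le_rfl, le_max_right _ _⟩, rfl⟩
    (image_mono (Icc_subset_Icc le_rfl (max_le_max hst le_rfl)))

theorem runningSup_of_nonpos {s : ℝ} (hs : s ≤ 0) : runningSup f s = f 0 := by
  simp [runningSup, max_eq_right hs]

theorem runningSup_of_nonneg {s : ℝ} (hs : 0 ≤ s) : runningSup f s = sSup (f '' Icc 0 s) := by
  rw [runningSup, max_eq_left hs]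

theorem continuous_runningSup (hf : ContinuousOn f (Ici 0)) : Continuous (runningSup f) := by
  have hf' : Continuous fun s => f (max s 0) :=
    hf.comp_continuous (by fun_prop) fun s => mem_Ici.2 (le_max_right _ _)
  have h : Continuous fun s : ℝ => sSup ((fun t => f (max (max s 0 * t) 0)) '' Icc (0 : ℝ) 1) :=
    isCompact_Icc.continuous_sSup (f := fun s t : ℝ => f (max (max s 0 * t) 0))
      (hf'.comp (by fun_prop : Continuous fun q : ℝ × ℝ => max q.1 0 * q.2))
  convert h using 2 with s
  have hs : 0 ≤ max s 0 := le_max_right _ _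
  rw [runningSup]
  congr 1
  ext y
  constructor
  · rintro ⟨x, hx, rfl⟩
    rcases hs.eq_or_lt with h0 | h0
    · refine ⟨0, by simp, ?_⟩
      rw [← h0] at hx ⊢
      simp [le_antisymm hx.2 hx.1]
    · refine ⟨x / max s 0, ⟨div_nonneg hx.1 hs, (div_le_one h0).2 hx.2⟩, ?_⟩
      simp only [mul_div_cancel₀ _ h0.ne', max_eq_left hx.1]
  · rintro ⟨t, ht, rfl⟩
    have h1 : 0 ≤ max s 0 * t := mul_nonneg hs ht.1
    exact ⟨max s 0 * t, ⟨h1, mul_le_of_le_one_right hs ht.2⟩, by simp only [max_eq_left h1]⟩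

/-- Under the growth hypothesis on the running supremum, its primitive is controlled by that
of `f`. -/
theorem exists_one_add_integral_runningSup_le (hf : ContinuousOn f (Ici 0)) (hf0 : f 0 = 0)
    (hpos : ∀ s > 0, 0 < f s)
    (hb : IsBoundedUnder (· ≤ ·) atTop fun s => sSup (f '' Icc 0 s) / f s) :
    ∃ C : ℝ, 0 < C ∧ ∀ t ≥ 1,
      1 + ∫ s in (0 : ℝ)..t, runningSup f s ≤ C * ∫ s in (0 : ℝ)..t, f s := by
  obtain ⟨B, hB⟩ := hb
  rw [eventually_map] at hB
  obtain ⟨t₀, ht₀⟩ := (hB.and (eventually_ge_atTop 1)).exists_forall_of_atTop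
  have ht₀1 : 1 ≤ t₀ := (ht₀ t₀ le_rfl).2
  have hint : ∀ {a b : ℝ}, 0 ≤ a → 0 ≤ b → IntervalIntegrable f volume a b :=
    fun ha hb => intervalIntegrable_of_continuousOn_Ici hf ha hb
  have hk := continuous_runningSup hf
  have hki : ∀ a b : ℝ, IntervalIntegrable (runningSup f) volume a b :=
    fun a b => hk.intervalIntegrable a b
  have hk0 (s : ℝ) : 0 ≤ runningSup f s := by
    rcases le_total s 0 with h | h
    · rw [runningSup_of_nonpos h, hf0]
    · rw [← hf0, ← runningSup_of_nonpos (f := f) le_rfl]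
      exact monotone_runningSup hf h
  have hf_nonneg : ∀ s, 0 ≤ s → 0 ≤ f s := fun s hs => by
    rcases hs.eq_or_lt with rfl | h
    · exact hf0.ge
    · exact (hpos s h).le
  have hkB : ∀ s ≥ t₀, runningSup f s ≤ max B 0 * f s := fun s hs => by
    have h1 : 0 < s := by linarith
    rw [runningSup_of_nonneg h1.le]
    refine ((div_le_iff₀ (hpos s h1)).1 (ht₀ s hs).1).trans ?_
    exact mul_le_mul_of_nonneg_right (le_max_left _ _) (hpos s h1).le
  set F : ℝ → ℝ := fun t => ∫ s in (0 : ℝ)..t, f s with hF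
  set G : ℝ → ℝ := fun t => 1 + ∫ s in (0 : ℝ)..t, runningSup f s with hG
  have hF1 : 0 < F 1 := intervalIntegral.intervalIntegral_pos_of_pos_on (hint le_rfl zero_le_one)
    (fun x hx => hpos x hx.1) one_pos
  have hFdiff : ∀ a b : ℝ, 0 ≤ a → a ≤ b → F b - F a = ∫ s in a..b, f s := fun a b ha hab =>
    intervalIntegral.integral_interval_sub_left (hint le_rfl (ha.trans hab)) (hint le_rfl ha)
  have hGdiff : ∀ a b : ℝ, G b - G a = ∫ s in a..b, runningSup f s := fun a b => by
    simp only [hG, add_sub_add_left_eq_sub]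
    exact intervalIntegral.integral_interval_sub_left (hki _ _) (hki _ _)
  have hFmono : ∀ a b : ℝ, 0 ≤ a → a ≤ b → F a ≤ F b := fun a b ha hab => by
    rw [← sub_nonneg, hFdiff a b ha hab]
    exact intervalIntegral.integral_nonneg hab fun x hx => hf_nonneg x (ha.trans hx.1)
  have hGmono : ∀ a b : ℝ, a ≤ b → G a ≤ G b := fun a b hab => by
    rw [← sub_nonneg, hGdiff a b]
    exact intervalIntegral.integral_nonneg hab fun x _ => hk0 x
  have hG1 : 1 ≤ G t₀ := by
    have := hGmono 0 t₀ (by linarith)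
    simpa [hG] using this
  have hquot : 0 < G t₀ / F 1 := by positivity
  refine ⟨G t₀ / F 1 + max B 0, by positivity, fun t ht => ?_⟩
  change G t ≤ _ * F t
  have hFt : F 1 ≤ F t := hFmono 1 t zero_le_one ht
  have hGF : G t₀ ≤ G t₀ / F 1 * F t := by
    calc G t₀ = G t₀ / F 1 * F 1 := (div_mul_cancel₀ _ hF1.ne').symm
      _ ≤ _ := mul_le_mul_of_nonneg_left hFt hquot.le
  have hBF : 0 ≤ max B 0 * F t := mul_nonneg (le_max_right _ _) (hF1.le.trans hFt)
  rw [add_mul]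
  rcases le_total t t₀ with h | h
  · linarith [hGmono t t₀ h]
  · have h1 : G t - G t₀ ≤ max B 0 * (F t - F t₀) := by
      rw [hGdiff, hFdiff t₀ t (by linarith) h, ← intervalIntegral.integral_const_mul]
      exact intervalIntegral.integral_mono_on h (hki _ _)
        ((hint (by linarith) (by linarith)).const_mul _) fun x hx => hkB x hx.1
    have h2 : 0 ≤ max B 0 * F t₀ :=
      mul_nonneg (le_max_right _ _) (hF1.le.trans (hFmono 1 t₀ zero_le_one ht₀1))
    linarith

end RunningSup

section Subsolution

theorem tendsto_integral_atTop_of_not_integrableOn {g : ℝ → ℝ} (hg : Continuous g)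
    (hpos : ∀ s, 0 ≤ g s) (h : ¬ IntegrableOn g (Ioi 1)) :
    Tendsto (fun s => ∫ t in (0 : ℝ)..s, g t) atTop atTop := by
  have hi (a b : ℝ) : IntervalIntegrable g volume a b := hg.intervalIntegrable a b
  have hmono : Monotone fun s => ∫ t in (0 : ℝ)..s, g t := fun a b hab => by
    rw [← sub_nonneg, intervalIntegral.integral_interval_sub_left (hi _ _) (hi _ _)]
    exact intervalIntegral.integral_nonneg hab fun x _ => hpos x
  refine tendsto_atTop_atTop_of_monotone hmono fun M => ?_
  by_contra! hM
  refine h (integrableOn_Ioi_of_intervalIntegral_norm_bounded (l := atTop) (b := id) M 1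
    (fun i => (hi 1 i).1) tendsto_id (Eventually.of_forall fun i => ?_))
  simp only [Real.norm_of_nonneg (hpos _), id]
  rw [← intervalIntegral.integral_interval_sub_left (hi 0 i) (hi 0 1)]
  have := intervalIntegral.integral_nonneg (μ := volume) zero_le_one fun x _ => hpos x
  linarith [hM i]

/-- A global one-dimensional solution `W` of `(φ(W')W')' ≥ A k(W)`, growing to infinity, when the
Keller–Osserman integral of `k` diverges. -/
theorem exists_one_dim_subsolution {φ Φ Φinv : ℝ → ℝ}
    (hφC1 : ContDiffOn ℝ 1 φ (Ioi 0)) (hφpos : ∀ t > 0, 0 < φ t)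
    (hΦ : ∀ t : ℝ, Φ t = ∫ s in (0 : ℝ)..|t|, φ s * s) {l₁ : ℝ} (hl₁ : 0 < l₁)
    (hφ3 : ∀ t > 0, l₁ ≤ deriv (fun s => φ s * s) t * t / (φ t * t))
    (hnonneg : ∀ t ≥ 0, 0 ≤ Φinv t) (hleft : ∀ t ≥ 0, Φinv (Φ t) = t)
    (hright : ∀ t ≥ 0, Φ (Φinv t) = t)
    {k : ℝ → ℝ} (hk : Continuous k) (hk0 : ∀ s, 0 ≤ k s) (hkneg : ∀ s ≤ 0, k s = 0)
    {A : ℝ} (hA : 0 < A)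
    (hKO : ¬ IntegrableOn (fun t => (Φinv (A / l₁ * (1 + ∫ s in (0 : ℝ)..t, k s)))⁻¹) (Ioi 1)) :
    ∃ W V D : ℝ → ℝ, (∀ y, HasDerivAt W (V y) y) ∧ (∀ y, 0 < V y) ∧ Continuous V ∧
      (∀ y, HasDerivAt (fun y => φ (V y) * V y) (D y) y) ∧ Continuous D ∧
      (∀ y, A * k (W y) ≤ D y) ∧ Tendsto W atTop atTop := by
  have hp := continuousOn_mul_self hφC1 hφpos hl₁ hφ3
  have hppos : ∀ t > 0, 0 < φ t * t := fun t ht => mul_pos (hφpos t ht) ht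
  have hpC1 : ContDiffOn ℝ 1 (fun s => φ s * s) (Ioi 0) := hφC1.mul contDiffOn_id
  set H : ℝ → ℝ := fun t => A / l₁ * (1 + ∫ s in (0 : ℝ)..t, k s) with hH
  have hHder (s : ℝ) : HasDerivAt H (A / l₁ * k s) s :=
    ((hk.integral_hasStrictDerivAt 0 s).hasDerivAt.const_add 1).const_mul _
  have hAl : 0 < A / l₁ := div_pos hA hl₁
  have hHmono : Monotone H := monotone_of_deriv_nonneg (fun s => (hHder s).differentiableAt)
    fun s => by rw [(hHder s).deriv]; exact mul_nonneg hAl.le (hk0 s)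
  have hHneg : ∀ s ≤ 0, H s = A / l₁ := fun s hs => by
    have : ∫ t in (0 : ℝ)..s, k t = 0 := by
      rw [intervalIntegral.integral_congr (g := fun _ => 0)]
      · simp
      · intro t ht
        rw [uIcc_of_ge hs] at ht
        exact hkneg t ht.2
    simp [hH, this]
  have hHpos (s : ℝ) : 0 < H s := by
    rcases le_total s 0 with h | h
    · rwa [hHneg s h]
    · exact (hAl.trans_eq (hHneg 0 le_rfl).symm).trans_le (hHmono h)
  set g : ℝ → ℝ := fun s => Φinv (H s) with hg
  have hgpos (s : ℝ) : 0 < g s := youngInverse_pos (by simp [hΦ]) hnonneg hright (hHpos s)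
  have hgder (s : ℝ) : HasDerivAt g ((φ (g s) * g s)⁻¹ * (A / l₁ * k s)) s :=
    (hasDerivAt_youngInverse hp hppos hΦ hnonneg hleft hright (hHpos s)).comp s (hHder s)
  have hgcont : Continuous g := continuous_iff_continuousAt.2 fun s => (hgder s).continuousAt
  have hgi : Continuous fun s => (g s)⁻¹ := hgcont.inv₀ fun s => (hgpos s).ne'
  have htop := tendsto_integral_atTop_of_not_integrableOn hgi (fun s => (inv_pos.2 (hgpos s)).le)
    hKO
  have hbot : Tendsto (fun s => ∫ t in (0 : ℝ)..s, (g t)⁻¹) atBot atBot := by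
    have h0 : Tendsto (fun s : ℝ => s * (g 0)⁻¹) atBot atBot :=
      tendsto_id.atBot_mul_const (inv_pos.2 (hgpos 0))
    refine h0.congr' ?_
    filter_upwards [eventually_le_atBot 0] with s hs
    rw [intervalIntegral.integral_congr (g := fun _ => (g 0)⁻¹)]
    · simp
    · intro t ht
      rw [uIcc_of_ge hs] at ht
      simp only [hg, hHneg t ht.2, hHneg 0 le_rfl]
  obtain ⟨W, hW, hWtop⟩ := exists_global_solution hgcont hgpos htop hbot
  have hWc : Continuous W := continuous_iff_continuousAt.2 fun y => (hW y).continuousAt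
  have hVc : Continuous fun y => g (W y) := hgcont.comp hWc
  have hpd (t : ℝ) (ht : 0 < t) : HasDerivAt (fun s => φ s * s) (deriv (fun s => φ s * s) t) t :=
    ((hpC1.contDiffAt (Ioi_mem_nhds ht)).differentiableAt one_ne_zero).hasDerivAt
  refine ⟨W, fun y => g (W y), fun y => deriv (fun s => φ s * s) (g (W y)) *
    ((φ (g (W y)) * g (W y))⁻¹ * (A / l₁ * k (W y)) * g (W y)), hW, fun y => hgpos _, hVc,
    fun y => ?_, ?_, fun y => ?_, hWtop⟩
  · exact (hpd _ (hgpos _)).comp y (h := fun y => g (W y)) ((hgder (W y)).comp y (hW y))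
  · have h1 : Continuous fun y => deriv (fun s => φ s * s) (g (W y)) :=
      (hpC1.continuousOn_deriv_of_isOpen isOpen_Ioi le_rfl).comp_continuous hVc
        fun y => hgpos _
    have h2 : Continuous fun y => φ (g (W y)) * g (W y) :=
      hp.comp_continuous hVc fun y => (hgpos _).le
    exact h1.mul (((h2.inv₀ fun y => (hppos _ (hgpos _)).ne').mul
      (continuous_const.mul (hk.comp hWc))).mul hVc)
  · have h := mul_le_mul_of_nonneg_right (hφ3 (g (W y)) (hgpos _))
      (mul_nonneg hAl.le (hk0 (W y)))
    have e : A * k (W y) = l₁ * (A / l₁ * k (W y)) := by field_simp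
    rw [e]
    refine h.trans_eq ?_
    rw [div_eq_mul_inv]
    ring

end Subsolution

section PlaneWave

variable {E : Type*} [NormedAddCommGroup E] [InnerProductSpace ℝ E]

theorem hasFDerivAt_comp_inner_add {W : ℝ → ℝ} {W' : ℝ} (e : E) (c : ℝ) {x : E}
    (hW : HasDerivAt W W' (⟪e, x⟫ + c)) :
    HasFDerivAt (fun x : E => W (⟪e, x⟫ + c)) (W' • innerSL ℝ e) x :=
  hW.comp_hasFDerivAt x ((innerSL ℝ e).hasFDerivAt.add_const c)

variable [FiniteDimensional ℝ E]

theorem gradient_comp_inner_add {W V : ℝ → ℝ} (hW : ∀ y, HasDerivAt W (V y) y) (e : E) (c : ℝ)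
    (x : E) : gradient (fun x : E => W (⟪e, x⟫ + c)) x = V (⟪e, x⟫ + c) • e := by
  refine HasGradientAt.gradient (hasGradientAt_iff_hasFDerivAt.2 ?_)
  have h := hasFDerivAt_comp_inner_add e c (hW (⟪e, x⟫ + c))
  have he : InnerProductSpace.toDual ℝ E (V (⟪e, x⟫ + c) • e) =
      V (⟪e, x⟫ + c) • innerSL ℝ e := by
    ext y
    simp
  rw [he]
  exact h

variable [MeasurableSpace E] [BorelSpace E]

/-- The function `x ↦ W(⟪e, x⟫ + c)` solves `div (φ(|∇w|)∇w) = D(⟪e, x⟫ + c)` weakly when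
`(φ(W')W')' = D`. -/
theorem weak_eq_planeWave {φ W V D : ℝ → ℝ} (hW : ∀ y, HasDerivAt W (V y) y)
    (hVpos : ∀ y, 0 < V y) (hP : ∀ y, HasDerivAt (fun y => φ (V y) * V y) (D y) y)
    (hD : Continuous D) {e : E} (he : ‖e‖ = 1) (c : ℝ) {ψ : E → ℝ} (hψ : ContDiff ℝ 1 ψ)
    (hc : HasCompactSupport ψ) :
    (∫ x, ⟪φ ‖gradient (fun x : E => W (⟪e, x⟫ + c)) x‖ •
        gradient (fun x : E => W (⟪e, x⟫ + c)) x, gradient ψ x⟫) +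
      (∫ x, D (⟪e, x⟫ + c) * ψ x) = 0 := by
  let P : E → ℝ := fun x => φ (V (⟪e, x⟫ + c)) * V (⟪e, x⟫ + c)
  have hPd (x : E) : HasFDerivAt P (D (⟪e, x⟫ + c) • innerSL ℝ e) x :=
    hasFDerivAt_comp_inner_add (W := fun y => φ (V y) * V y) e c (hP _)
  have hPc : Continuous P := continuous_iff_continuousAt.2 fun x => (hPd x).continuousAt
  have hPe (x : E) : fderiv ℝ P x e = D (⟪e, x⟫ + c) := by
    rw [(hPd x).fderiv]
    simp [he]
  have hDc : Continuous fun x : E => D (⟪e, x⟫ + c) := hD.comp (by fun_prop)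
  have hdψ : Continuous fun x => fderiv ℝ ψ x e :=
    (hψ.continuous_fderiv one_ne_zero).clm_apply continuous_const
  have hdψc : HasCompactSupport fun x => fderiv ℝ ψ x e := hc.fderiv_apply ℝ e
  have key := integral_mul_fderiv_eq_neg_fderiv_mul_of_integrable (μ := volume) (f := P) (g := ψ)
    (v := e)
    (by simp only [hPe]; exact (hDc.mul hψ.continuous).integrable_of_hasCompactSupport hc.mul_left)
    ((hPc.mul hdψ).integrable_of_hasCompactSupport hdψc.mul_left)
    ((hPc.mul hψ.continuous).integrable_of_hasCompactSupport hc.mul_left)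
    (fun x _ => (hPd x).differentiableAt) (fun x _ => hψ.differentiable one_ne_zero x)
  simp only [hPe] at key
  have hint (x : E) : ⟪φ ‖gradient (fun x : E => W (⟪e, x⟫ + c)) x‖ •
      gradient (fun x : E => W (⟪e, x⟫ + c)) x, gradient ψ x⟫ = P x * fderiv ℝ ψ x e := by
    rw [gradient_comp_inner_add hW, norm_smul, he, mul_one, Real.norm_of_nonneg (hVpos _).le,
      smul_smul, real_inner_smul_left, inner_gradient_right]
    simp [P]
  simp only [hint]
  rw [key, neg_add_cancel]

end PlaneWave

/-- Divergence of the Keller–Osserman integral passes to comparable primitives. -/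
theorem not_integrableOn_inv_youngInverse {p Φ Φinv f G : ℝ → ℝ} (hp : ContinuousOn p (Ici 0))
    (hpos : ∀ t > 0, 0 < p t) (hmono : MonotoneOn p (Ici 0))
    (hΦ : ∀ t, Φ t = ∫ s in (0 : ℝ)..|t|, p s) (hnonneg : ∀ t ≥ 0, 0 ≤ Φinv t)
    (hleft : ∀ t ≥ 0, Φinv (Φ t) = t) (hright : ∀ t ≥ 0, Φ (Φinv t) = t)
    (hf : ContinuousOn f (Ici 0)) (hfpos : ∀ s > 0, 0 < f s)
    (hKO : ¬ IntegrableOn (fun t => 1 / Φinv (∫ s in (0 : ℝ)..t, f s)) (Ioi 1))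
    {C : ℝ} (hGpos : ∀ t ≥ 1, 0 < G t) (hG : ∀ t ≥ 1, G t ≤ C * ∫ s in (0 : ℝ)..t, f s) :
    ¬ IntegrableOn (fun t => (Φinv (G t))⁻¹) (Ioi 1) := by
  intro hint
  refine hKO ((hint.const_mul (max C 1)).mono' ?_ ?_)
  · refine ContinuousOn.aestronglyMeasurable (fun t ht => ?_) measurableSet_Ioi
    have ht0 : 0 < t := zero_lt_one.trans ht
    have hFpos : 0 < ∫ s in (0 : ℝ)..t, f s := intervalIntegral.intervalIntegral_pos_of_pos_on
      (intervalIntegrable_of_continuousOn_Ici hf le_rfl ht0.le) (fun x hx => hfpos x hx.1) ht0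
    have hFc : ContinuousAt (fun t => ∫ s in (0 : ℝ)..t, f s) t := by
      have h := hasDerivAt_youngFunction (Φ := fun t => ∫ s in (0 : ℝ)..|t|, f s) hf
        (fun _ => rfl) ht0
      refine h.continuousAt.congr ?_
      filter_upwards [Ioi_mem_nhds ht0] with s hs
      rw [abs_of_pos hs]
    have hI := (hasDerivAt_youngInverse hp hpos hΦ hnonneg hleft hright hFpos).continuousAt
    exact (continuousAt_const.div
      (ContinuousAt.comp (f := fun t => ∫ s in (0 : ℝ)..t, f s) hI hFc)
      (youngInverse_pos (by simp [hΦ]) hnonneg hright hFpos).ne').continuousWithinAt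
  · refine (ae_restrict_iff' measurableSet_Ioi).2 (Eventually.of_forall fun t ht => ?_)
    have ht1 : 1 ≤ t := le_of_lt ht
    have ht0 : 0 < t := zero_lt_one.trans ht
    have hFpos : 0 < ∫ s in (0 : ℝ)..t, f s := intervalIntegral.intervalIntegral_pos_of_pos_on
      (intervalIntegrable_of_continuousOn_Ici hf le_rfl ht0.le) (fun x hx => hfpos x hx.1) ht0
    have hIF := youngInverse_pos (by simp [hΦ]) hnonneg hright hFpos
    have hIG := youngInverse_pos (by simp [hΦ]) hnonneg hright (hGpos t ht1)
    have hle : G t ≤ max C 1 * ∫ s in (0 : ℝ)..t, f s :=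
      (hG t ht1).trans (mul_le_mul_of_nonneg_right (le_max_left _ _) hFpos.le)
    have h1 : Φinv (G t) ≤ max C 1 * Φinv (∫ s in (0 : ℝ)..t, f s) :=
      ((strictMonoOn_youngInverse (strictMonoOn_youngFunction hp hpos hΦ) hnonneg
        hright).monotoneOn (hGpos t ht1).le ((hGpos t ht1).le.trans hle) hle).trans
        (youngInverse_mul_le hp hpos hmono hΦ hnonneg hright (le_max_right _ _) hFpos.le)
    rw [Real.norm_of_nonneg (by positivity), div_le_iff₀ hIF, mul_right_comm,
      ← div_eq_mul_inv, le_div_iff₀ hIG, one_mul]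
    exact h1

/-- In a bounded open set, the points where a bounded function fails to be dominated by a function
blowing up at the boundary lie in a compact subset. -/
theorem exists_isCompact_of_boundary_blowup {E : Type*} [NormedAddCommGroup E] [ProperSpace E]
    {Ω : Set E} (hΩ : IsOpen Ω) (hbdd : Bornology.IsBounded Ω) {u w : E → ℝ} (hw : Continuous w)
    (hu : ∀ M : ℝ, ∃ δ > (0 : ℝ), ∀ x ∈ Ω, Metric.infDist x (frontier Ω) < δ → M < u x) :
    ∃ K, IsCompact K ∧ K ⊆ Ω ∧ ∀ x ∈ Ω, x ∉ K → w x ≤ u x := by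
  have hcl : IsCompact (closure Ω) := hbdd.isCompact_closure
  obtain ⟨M, hM⟩ := hcl.bddAbove_image hw.continuousOn
  obtain ⟨δ, hδ, hδu⟩ := hu M
  refine ⟨closure Ω ∩ {x | δ ≤ Metric.infDist x (frontier Ω)}, ?_, ?_, fun x hx hxK => ?_⟩
  · exact hcl.inter_right (isClosed_le continuous_const (Metric.continuous_infDist_pt _))
  · rintro x ⟨hx, hxδ⟩
    by_contra hxΩ
    have hfr : x ∈ frontier Ω := by rw [hΩ.frontier_eq]; exact ⟨hx, hxΩ⟩
    have h0 : δ ≤ 0 := by simpa [Metric.infDist_zero_of_mem hfr] using hxδ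
    exact absurd h0 (not_le.2 hδ)
  · have hlt : Metric.infDist x (frontier Ω) < δ :=
      not_le.1 fun h => hxK ⟨subset_closure hx, h⟩
    exact (hM ⟨x, subset_closure hx, rfl⟩).trans (hδu x hx hlt).le

/-- Theorem 1.1(ii), nonexistence: under (φ₁)-(φ₃), if Ω is a
smooth bounded domain, a is continuous, non-negative and c_Ω-positive, f is
continuous with f(0) = 0, f > 0 on (0,∞), satisfies (f̄) and fails the
φ-Keller–Osserman condition, then the problem Δ_φ u = a(x)f(u) in Ω, u ≥ 0,
u = ∞ on ∂Ω, has no solution u ∈ C¹(Ω). -/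
theorem stmt14
    (N : ℕ) (hN : 1 ≤ N)
    (φ Φ Φinv : ℝ → ℝ)
    (hφC1 : ContDiffOn ℝ 1 φ (Set.Ioi 0))
    (hφpos : ∀ t > (0:ℝ), 0 < φ t)
    (hΦ : ∀ t : ℝ, Φ t = ∫ s in (0:ℝ)..|t|, φ s * s)
    (hφ1 : ∀ t > (0:ℝ), 0 < deriv (fun s => φ s * s) t)
    (l m l₁ m₁ : ℝ) (hl : 1 < l) (hm : 1 < m)
    (hφ2 : ∀ t > (0:ℝ), l ≤ φ t * t ^ 2 / Φ t ∧ φ t * t ^ 2 / Φ t ≤ m)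
    (hl₁ : 0 < l₁) (hm₁ : 0 < m₁)
    (hφ3 : ∀ t > (0:ℝ), l₁ ≤ deriv (fun s => φ s * s) t * t / (φ t * t) ∧
      deriv (fun s => φ s * s) t * t / (φ t * t) ≤ m₁)
    (hΦinv_nonneg : ∀ t ≥ (0:ℝ), 0 ≤ Φinv t)
    (hΦinv_left : ∀ t ≥ (0:ℝ), Φinv (Φ t) = t)
    (hΦinv_right : ∀ t ≥ (0:ℝ), Φ (Φinv t) = t)
    (Ω : Set (EuclideanSpace ℝ (Fin N)))
    (hΩ_open : IsOpen Ω) (hΩ_bdd : Bornology.IsBounded Ω)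
    (hΩ_ne : Ω.Nonempty) (hΩ_conn : IsConnected Ω)
    (a : EuclideanSpace ℝ (Fin N) → ℝ)
    (ha_cont : ContinuousOn a (closure Ω))
    (ha_nonneg : ∀ x ∈ closure Ω, 0 ≤ a x)
    (ha_cpos : ∀ x₀ ∈ Ω, a x₀ = 0 →
      ∃ O : Set (EuclideanSpace ℝ (Fin N)), IsOpen O ∧ O ⊆ Ω ∧ x₀ ∈ O ∧
        ∀ x ∈ frontier O, 0 < a x)
    (f : ℝ → ℝ)
    (hf_cont : ContinuousOn f (Set.Ici 0))
    (hf0 : f 0 = 0)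
    (hf_pos : ∀ s > (0:ℝ), 0 < f s)
    (hf_limsup : Filter.IsBoundedUnder (· ≤ ·) Filter.atTop
      (fun s => sSup (f '' Set.Icc 0 s) / f s))
    (hKO_fail : ¬ IntegrableOn (fun t => 1 / Φinv (∫ s in (0:ℝ)..t, f s)) (Set.Ioi 1)) :
    ¬ ∃ u : EuclideanSpace ℝ (Fin N) → ℝ,
      ContDiffOn ℝ 1 u Ω ∧
      (∀ x ∈ Ω, 0 ≤ u x) ∧
      (∀ ψ : EuclideanSpace ℝ (Fin N) → ℝ, ContDiff ℝ (⊤ : ℕ∞) ψ → HasCompactSupport ψ →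
        tsupport ψ ⊆ Ω →
        (∫ x in Ω, φ ‖gradient u x‖ * ⟪gradient u x, gradient ψ x⟫) +
          (∫ x in Ω, a x * f (u x) * ψ x) = 0) ∧
      (∀ M : ℝ, ∃ δ > (0:ℝ), ∀ x ∈ Ω, Metric.infDist x (frontier Ω) < δ → M < u x) := by
  rintro ⟨u, hu, hu0, hweak, hblow⟩
  have hφ3' := fun t ht => (hφ3 t ht).1
  have hp := continuousOn_mul_self hφC1 hφpos hl₁ hφ3'
  have hppos : ∀ t > 0, 0 < φ t * t := fun t ht => mul_pos (hφpos t ht) ht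
  have hmono : MonotoneOn (fun t => φ t * t) (Ici 0) :=
    (strictMonoOn_of_deriv_pos (convex_Ici 0) hp
      (by rw [interior_Ici]; exact fun t ht => hφ1 t ht)).monotoneOn
  obtain ⟨M, hM⟩ := hΩ_bdd.isCompact_closure.bddAbove_image ha_cont
  set A := max M 0 + 1 with hA
  have hA0 : 0 < A := by positivity
  have haA : ∀ x ∈ Ω, a x < A := fun x hx =>
    ((hM ⟨x, subset_closure hx, rfl⟩).trans (le_max_left _ _)).trans_lt (lt_add_one _)
  have hk := continuous_runningSup hf_cont
  have hkmono := monotone_runningSup hf_cont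
  have hkneg : ∀ s ≤ 0, runningSup f s = 0 := fun s hs => by rw [runningSup_of_nonpos hs, hf0]
  have hk0 (s : ℝ) : 0 ≤ runningSup f s := by
    rcases le_total s 0 with h | h
    · exact (hkneg s h).ge
    · exact (hkneg 0 le_rfl).ge.trans (hkmono h)
  obtain ⟨C, hC, hCle⟩ :=
    exists_one_add_integral_runningSup_le hf_cont hf0 hf_pos hf_limsup
  have hKO := not_integrableOn_inv_youngInverse hp hppos hmono hΦ hΦinv_nonneg hΦinv_left
    hΦinv_right hf_cont hf_pos hKO_fail (C := A / l₁ * C)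
    (G := fun t => A / l₁ * (1 + ∫ s in (0 : ℝ)..t, runningSup f s))
    (fun t ht => mul_pos (div_pos hA0 hl₁) (add_pos_of_pos_of_nonneg one_pos
      (intervalIntegral.integral_nonneg (zero_le_one.trans ht) fun s _ => hk0 s)))
    (fun t ht => by
      rw [mul_assoc]
      exact mul_le_mul_of_nonneg_left (hCle t ht) (div_pos hA0 hl₁).le)
  obtain ⟨W, V, D, hW, hVpos, hVc, hP, hDc, hD, hWtop⟩ := exists_one_dim_subsolution hφC1 hφpos hΦ
    hl₁ hφ3' hΦinv_nonneg hΦinv_left hΦinv_right hk hk0 hkneg hA0 hKO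
  have hWC1 : ContDiff ℝ 1 W := contDiff_one_iff_deriv.2
    ⟨fun y => (hW y).differentiableAt, by rwa [funext fun y => (hW y).deriv]⟩
  let e : EuclideanSpace ℝ (Fin N) := EuclideanSpace.single ⟨0, hN⟩ 1
  have he : ‖e‖ = 1 := by simp [e]
  obtain ⟨x₀, hx₀⟩ := hΩ_ne
  have hbound (c : ℝ) : W (⟪e, x₀⟫ + c) ≤ u x₀ := by
    have hwC1 : ContDiff ℝ 1 fun x : EuclideanSpace ℝ (Fin N) => W (⟪e, x⟫ + c) :=
      hWC1.comp ((innerSL ℝ e).contDiff.add contDiff_const)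
    obtain ⟨K, hK, hKΩ, hKle⟩ :=
      exists_isCompact_of_boundary_blowup hΩ_open hΩ_bdd hwC1.continuous hblow
    refine le_of_weak_solution hΩ_open hK hKΩ hφpos hφC1.continuousOn hp hmono hu hwC1
      (h := fun x => a x * f (u x)) (D := fun x => D (⟪e, x⟫ + c)) ?_ (hDc.comp (by fun_prop))
      hweak (fun ψ hψ hc => weak_eq_planeWave hW hVpos hP hDc he c hψ hc) (fun x hx hlt => ?_)
      hKle x₀ hx₀
    · exact (ha_cont.mono subset_closure).mul (hf_cont.comp hu.continuousOn hu0)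
    · set y := W (⟪e, x⟫ + c)
      have hy : 0 < y := (hu0 x hx).trans_lt hlt
      have hky : 0 < runningSup f y := (hf_pos y hy).trans_le (le_runningSup hf_cont hy.le)
      calc a x * f (u x) ≤ a x * runningSup f y :=
            mul_le_mul_of_nonneg_left ((le_runningSup hf_cont (hu0 x hx)).trans (hkmono hlt.le))
              (ha_nonneg x (subset_closure hx))
        _ < A * runningSup f y := mul_lt_mul_of_pos_right (haA x hx) hky
        _ ≤ D (⟪e, x⟫ + c) := hD _
  obtain ⟨y, hy⟩ := (hWtop.eventually_gt_atTop (u x₀)).exists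
  have := hbound (y - ⟪e, x₀⟫)
  rw [add_sub_cancel] at this
  exact absurd this (not_le.2 hy)
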